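/- Let n ≥ 3 be an integer, h > 0, Ĉ > 0, and let U ⊆ ℝ² be open. Let λ₁, …, λₙ : U → ℝ be differentiable with λ_k(x) ≥ 0, Σ_{k=1}^n λ_k(x) = 1, and ‖∇λ_k(x)‖ ≤ Ĉ for all x ∈ U and all k. Let (h_{jk})_{1≤j,k≤n} be reals with 0 ≤ h_{jk} ≤ h, and let M₁, …, Mₙ ∈ [0,1]. Define Ŵ : U → ℝ by Ŵ(x) := Σ_{i=1}^n M_i ∏_{j∉{i−1,i (mod n)}} (Σ_{k=1}^n λ_k(x) h_{jk}). Then for every x ∈ U, ‖∇Ŵ(x)‖ ≤ n³ Ĉ h^{n−2}. -/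

import Mathlib

noncomputable section

/-- The Euclidean plane. -/
abbrev E2 : Type := EuclideanSpace ℝ (Fin 2)

/-- A product of functions with values in `[0, h]` and derivatives of norm at most `C * h` has
derivative of norm at most `#s * C * h ^ #s`. -/
theorem norm_fderiv_finset_prod_le {E ι : Type*} [NormedAddCommGroup E] [NormedSpace ℝ E]
    {s : Finset ι} {g : ι → E → ℝ} {x : E} {h C : ℝ} (hg : ∀ j ∈ s, DifferentiableAt ℝ (g j) x)
    (hg0 : ∀ j ∈ s, 0 ≤ g j x) (hgh : ∀ j ∈ s, g j x ≤ h)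
    (hg' : ∀ j ∈ s, ‖fderiv ℝ (g j) x‖ ≤ C * h) :
    ‖fderiv ℝ (fun y => ∏ j ∈ s, g j y) x‖ ≤ s.card * C * h ^ s.card := by
  classical
  rw [fderiv_finsetProd hg]
  have key : ∀ j ∈ s, ‖(∏ i ∈ s.erase j, g i x) • fderiv ℝ (g j) x‖ ≤ C * h ^ s.card := by
    intro j hj
    have hh : 0 ≤ h := (hg0 j hj).trans (hgh j hj)
    have hnn : 0 ≤ ∏ i ∈ s.erase j, g i x :=
      Finset.prod_nonneg fun i hi => hg0 i (Finset.mem_of_mem_erase hi)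
    have hle : ∏ i ∈ s.erase j, g i x ≤ h ^ (s.erase j).card := by
      rw [← Finset.prod_const]
      exact Finset.prod_le_prod (fun i hi => hg0 i (Finset.mem_of_mem_erase hi))
        fun i hi => hgh i (Finset.mem_of_mem_erase hi)
    rw [norm_smul, Real.norm_of_nonneg hnn]
    calc _ ≤ h ^ (s.erase j).card * (C * h) :=
          mul_le_mul hle (hg' j hj) (norm_nonneg _) (by positivity)
      _ = C * h ^ s.card := by
          rw [← Finset.card_erase_add_one hj, pow_succ]; ring
  calc _ ≤ ∑ _j ∈ s, C * h ^ s.card := norm_sum_le_of_le _ key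
    _ = s.card * C * h ^ s.card := by rw [Finset.sum_const, nsmul_eq_mul]; ring

/-- The norm of the gradient is the norm of the Fréchet derivative. -/
theorem norm_gradient_eq_norm_fderiv {F : Type*} [NormedAddCommGroup F] [InnerProductSpace ℝ F]
    [CompleteSpace F] (f : F → ℝ) (x : F) : ‖gradient f x‖ = ‖fderiv ℝ f x‖ :=
  LinearIsometryEquiv.norm_map _ _

/-- Removing two cyclically consecutive indices from `Fin n` leaves `n - 2` of them. -/
theorem card_filter_ne_sub_one_and_ne {n : ℕ} [NeZero n] (hn : 2 ≤ n) (i : Fin n) :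
    (Finset.univ.filter fun j : Fin n => j ≠ i - 1 ∧ j ≠ i).card = n - 2 := by
  have hne : i - 1 ≠ i := by
    have : Nontrivial (Fin n) := Fin.nontrivial_iff_two_le.mpr hn
    simp [sub_eq_self]
    lia
  have : (Finset.univ.filter fun j : Fin n => j ≠ i - 1 ∧ j ≠ i) = {i - 1, i}ᶜ := by
    ext j; simp
  rw [this, Finset.card_compl, Finset.card_pair hne, Fintype.card_fin]

/-- Gradient bound for the pullback of the Wachspress total weight: with
`Ŵ(x) = Σᵢ Mᵢ ∏_{j∉{i−1,i}} (Σₖ λₖ(x) h_{jk})`, where the `λₖ` are nonnegative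
differentiable functions summing to one with `‖∇λₖ‖ ≤ Ĉ`, `0 ≤ h_{jk} ≤ h` and
`Mᵢ ∈ [0,1]`, one has `‖∇Ŵ(x)‖ ≤ n³ Ĉ h^{n−2}` on `U`. -/
theorem stmt_14 (n : ℕ) [NeZero n] (hn : 3 ≤ n) (h Chat : ℝ) (hh : 0 < h)
    (hChat : 0 < Chat) (U : Set E2) (hU : IsOpen U) (lam : Fin n → E2 → ℝ)
    (hdiff : ∀ k, ∀ x ∈ U, DifferentiableAt ℝ (lam k) x)
    (hnn : ∀ k, ∀ x ∈ U, 0 ≤ lam k x)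
    (hsum : ∀ x ∈ U, ∑ k, lam k x = 1)
    (hgrad : ∀ k, ∀ x ∈ U, ‖gradient (lam k) x‖ ≤ Chat)
    (hjk : Fin n → Fin n → ℝ) (hjk0 : ∀ j k, 0 ≤ hjk j k) (hjkh : ∀ j k, hjk j k ≤ h)
    (M : Fin n → ℝ) (hM0 : ∀ i, 0 ≤ M i) (hM1 : ∀ i, M i ≤ 1) :
    ∀ x ∈ U,
      ‖gradient (fun y => ∑ i : Fin n, M i *
          ∏ j ∈ Finset.univ.filter (fun j : Fin n => j ≠ i - 1 ∧ j ≠ i),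
            (∑ k, lam k y * hjk j k)) x‖
        ≤ (n : ℝ) ^ 3 * Chat * h ^ (n - 2) := by
  intro x hx
  set g : Fin n → E2 → ℝ := fun j y => ∑ k, lam k y * hjk j k
  have hg : ∀ j, HasFDerivAt (g j) (∑ k, hjk j k • fderiv ℝ (lam k) x) x := fun j =>
    HasFDerivAt.fun_sum fun k _ => (hdiff k x hx).hasFDerivAt.mul_const (hjk j k)
  have hg0 : ∀ j, 0 ≤ g j x := fun j =>
    Finset.sum_nonneg fun k _ => mul_nonneg (hnn k x hx) (hjk0 j k)
  have hgh : ∀ j, g j x ≤ h := fun j =>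
    calc g j x ≤ ∑ k, lam k x * h :=
          Finset.sum_le_sum fun k _ => mul_le_mul_of_nonneg_left (hjkh j k) (hnn k x hx)
      _ = h := by rw [← Finset.sum_mul, hsum x hx, one_mul]
  have hg' : ∀ j, ‖fderiv ℝ (g j) x‖ ≤ n * Chat * h := fun j => by
    rw [(hg j).fderiv]
    calc _ ≤ ∑ _k : Fin n, h * Chat := norm_sum_le_of_le _ fun k _ => by
          rw [norm_smul, Real.norm_of_nonneg (hjk0 j k), ← norm_gradient_eq_norm_fderiv]
          exact mul_le_mul (hjkh j k) (hgrad k x hx) (norm_nonneg _) hh.le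
      _ = n * Chat * h := by simp; ring
  have hprod : ∀ i : Fin n, DifferentiableAt ℝ (fun y => ∏ j ∈ Finset.univ.filter
      (fun j : Fin n => j ≠ i - 1 ∧ j ≠ i), g j y) x := fun i =>
    (HasFDerivAt.finsetProd fun j _ => hg j).differentiableAt
  rw [norm_gradient_eq_norm_fderiv,
    (HasFDerivAt.fun_sum fun i _ => (hprod i).hasFDerivAt.const_mul (M i)).fderiv]
  calc _ ≤ ∑ _i : Fin n, (n : ℝ) * (n * Chat) * h ^ (n - 2) := norm_sum_le_of_le _ fun i _ => by
        have hi := norm_fderiv_finset_prod_le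
          (s := Finset.univ.filter fun j : Fin n => j ≠ i - 1 ∧ j ≠ i)
          (fun j _ => (hg j).differentiableAt) (fun j _ => hg0 j) (fun j _ => hgh j)
          fun j _ => hg' j
        rw [card_filter_ne_sub_one_and_ne (by lia)] at hi
        rw [norm_smul, Real.norm_of_nonneg (hM0 i)]
        refine (mul_le_of_le_one_left (norm_nonneg _) (hM1 i)).trans (hi.trans ?_)
        gcongr
        exact Nat.sub_le n 2
    _ = (n : ℝ) ^ 3 * Chat * h ^ (n - 2) := by simp; ring

end
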